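/- Let f, g ∈ K[[x,y]] be relatively prime, with K algebraically closed. Then there exist a unit u ∈ K[[x,y]] and a polynomial g' ∈ K[x,y] such that g ≡ u·g' modulo the ideal (f). -/

import Mathlib

open MvPowerSeries in
/-- Restriction to a coordinate axis. -/
noncomputable def axisHom (K : Type*) [Field K] (j : Fin 2) :
    MvPowerSeries (Fin 2) K →+* PowerSeries K where
  toFun p := PowerSeries.mk fun n => coeff (Finsupp.single j n) p
  map_one' := by
    ext n
    simp [MvPowerSeries.coeff_one, PowerSeries.coeff_one]
  map_zero' := by
    ext n
    simp
  map_add' p q := by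
    ext n
    simp
  map_mul' p q := by
    ext n
    rw [PowerSeries.coeff_mk, MvPowerSeries.coeff_mul, PowerSeries.coeff_mul,
      Finsupp.antidiagonal_single, Finset.sum_map]
    simp

lemma exists_coeff {K : Type*} [Field K] (F : (Fin 2 →₀ ℕ) → K) :
    ∃ s : MvPowerSeries (Fin 2) K, ∀ m, MvPowerSeries.coeff m s = F m :=
  ⟨F, fun _ => rfl⟩

open MvPowerSeries in
lemma axisHom_surj (K : Type*) [Field K] (j : Fin 2) :
    Function.Surjective (axisHom K j) := by
  intro q
  obtain ⟨s, hs⟩ := exists_coeff (fun m => PowerSeries.coeff (m j) q)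
  refine ⟨s, ?_⟩
  ext n
  change PowerSeries.coeff n (PowerSeries.mk fun n => coeff (Finsupp.single j n) s) = _
  rw [PowerSeries.coeff_mk, hs]
  simp

open MvPowerSeries in
lemma axisHom_ker {K : Type*} [Field K] {i j : Fin 2} (hij : i ≠ j)
    (p : MvPowerSeries (Fin 2) K) (hp : axisHom K j p = 0) : X i ∣ p := by
  rw [X_dvd_iff]
  intro m hm
  have h1 : m = Finsupp.single j (m j) := by
    ext k
    by_cases hk : k = j
    · subst hk; simp
    · have : k = i := by omega
      subst this
      simp [hm, hk]
  have h2 := congrArg (PowerSeries.coeff (m j)) hp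
  change PowerSeries.coeff (m j) (PowerSeries.mk fun n => coeff (Finsupp.single j n) p) = _ at h2
  rw [PowerSeries.coeff_mk, ← h1] at h2
  simpa using h2

open MvPowerSeries in
lemma X_adic_sum {K : Type*} [Field K] (i : Fin 2) (a : ℕ → MvPowerSeries (Fin 2) K) :
    ∃ s : MvPowerSeries (Fin 2) K, ∀ N, X i ^ N ∣ s - ∑ k ∈ Finset.range N, X i ^ k * a k := by
  obtain ⟨s, hs⟩ : ∃ s : MvPowerSeries (Fin 2) K,
      ∀ m, coeff m s = coeff m (∑ k ∈ Finset.range (m i + 1), X i ^ k * a k) :=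
    exists_coeff _
  refine ⟨s, fun N => ?_⟩
  rw [X_pow_dvd_iff]
  intro m hm
  rw [map_sub, sub_eq_zero, hs, ← Finset.sum_range_add_sum_Ico _ (show m i + 1 ≤ N by omega), map_add, left_eq_add]
  have : X i ^ (m i + 1) ∣ ∑ k ∈ Finset.Ico (m i + 1) N, X i ^ k * a k :=
    Finset.dvd_sum fun k hk =>
      (pow_dvd_pow _ (Finset.mem_Ico.1 hk).1).mul_right _
  rw [X_pow_dvd_iff] at this
  exact this m (by omega)

open MvPowerSeries in
lemma saturated_principal {K : Type*} [Field K] {i j : Fin 2} (hij : i ≠ j)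
    (J : Ideal (MvPowerSeries (Fin 2) K)) (hJ : ∀ p, X i * p ∈ J → p ∈ J) :
    ∃ h ∈ J, ∀ p ∈ J, h ∣ p := by
  obtain ⟨c, hc⟩ := (IsPrincipalIdealRing.principal (J.map (axisHom K j))).principal
  have hcm : c ∈ J.map (axisHom K j) := by rw [hc]; exact Ideal.mem_span_singleton_self c
  obtain ⟨h, hhJ, hhc⟩ := (Ideal.mem_map_iff_of_surjective _ (axisHom_surj K j)).1 hcm
  refine ⟨h, hhJ, fun p hp => ?_⟩
  have step : ∀ q : J, ∃ (a : MvPowerSeries (Fin 2) K) (r : J),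
      (q : MvPowerSeries (Fin 2) K) = h * a + X i * (r : MvPowerSeries (Fin 2) K) := by
    intro q
    have hq := Ideal.mem_map_of_mem (axisHom K j) q.2
    rw [hc] at hq
    obtain ⟨b, hb⟩ := Ideal.mem_span_singleton.1 hq
    obtain ⟨a, rfl⟩ := axisHom_surj K j b
    obtain ⟨r, hr⟩ := axisHom_ker hij ((q : MvPowerSeries (Fin 2) K) - h * a)
      (by rw [map_sub, map_mul, hb, hhc, sub_self])
    refine ⟨a, ⟨r, hJ _ ?_⟩, ?_⟩
    · rw [← hr]
      exact J.sub_mem q.2 (J.mul_mem_right _ hhJ)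
    · simp only [← hr]; ring
  choose A r hr using step
  let P : ℕ → J := fun n => r^[n] ⟨p, hp⟩
  obtain ⟨s, hs⟩ := X_adic_sum i (fun k => A (P k))
  have key : ∀ N, p = h * (∑ k ∈ Finset.range N, X i ^ k * A (P k)) + X i ^ N * (P N : MvPowerSeries (Fin 2) K) := by
    intro N
    induction N with
    | zero => simp [P]
    | succ n ih =>
      have h1 := hr (P n)
      have h2 : P (n + 1) = r (P n) := Function.iterate_succ_apply' _ _ _
      rw [Finset.sum_range_succ, h2]
      conv_lhs => rw [ih, h1]
      ring
  refine ⟨s, ?_⟩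
  rw [← sub_eq_zero]
  ext m
  have hd : X i ^ (m i + 1) ∣ p - h * s := by
    obtain ⟨t, ht⟩ := hs (m i + 1)
    refine ⟨(P (m i + 1) : MvPowerSeries (Fin 2) K) - h * t, ?_⟩
    have := key (m i + 1)
    linear_combination this - h * ht
  rw [X_pow_dvd_iff] at hd
  simpa using hd m (by omega)

open MvPowerSeries in
lemma X_pow_mem {K : Type*} [Field K] {i j : Fin 2} (hij : i ≠ j)
    (f g : MvPowerSeries (Fin 2) K) (h : IsRelPrime f g) :
    ∃ n, ∃ a b, (X i : MvPowerSeries (Fin 2) K) ^ n = a * f + b * g := by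
  let I : Ideal (MvPowerSeries (Fin 2) K) := Ideal.span {f, g}
  let J : Ideal (MvPowerSeries (Fin 2) K) :=
    { carrier := {p | ∃ n, X i ^ n * p ∈ I}
      zero_mem' := ⟨0, by simp⟩
      add_mem' := by
        rintro p q ⟨n, hn⟩ ⟨m, hm⟩
        refine ⟨n + m, ?_⟩
        have := I.add_mem (I.mul_mem_left (X i ^ m) hn) (I.mul_mem_left (X i ^ n) hm)
        convert this using 1
        ring
      smul_mem' := by
        rintro c p ⟨n, hn⟩
        refine ⟨n, ?_⟩
        have := I.mul_mem_left c hn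
        convert this using 1
        simp only [smul_eq_mul]
        ring }
  obtain ⟨d, ⟨n, hn⟩, hdv⟩ := saturated_principal hij J (by
    rintro p ⟨n, hn⟩
    refine ⟨n + 1, ?_⟩
    convert hn using 1
    ring)
  have hu : IsUnit d := h
    (hdv f ⟨0, by simpa using Ideal.subset_span (by simp)⟩)
    (hdv g ⟨0, by simpa using Ideal.subset_span (by simp)⟩)
  obtain ⟨e, he⟩ := hu.exists_right_inv
  have h3 := I.mul_mem_right e hn
  rw [mul_assoc, he, mul_one] at h3
  obtain ⟨a, b, hab⟩ := Ideal.mem_span_pair.1 h3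
  exact ⟨n, a, b, hab.symm⟩

open MvPowerSeries in
lemma exists_poly {K : Type*} [Field K] (n m : ℕ) (g : MvPowerSeries (Fin 2) K) :
    ∃ (g' : MvPolynomial (Fin 2) K) (A B : MvPowerSeries (Fin 2) K),
      g = (g' : MvPowerSeries (Fin 2) K) + X 0 ^ n * A + X 1 ^ m * B := by
  classical
  let d : Fin 2 →₀ ℕ := Finsupp.single 0 n + Finsupp.single 1 m
  let w : MvPowerSeries (Fin 2) K := g - ((trunc' K d g : MvPolynomial (Fin 2) K) :)
  obtain ⟨q, hq⟩ : ∃ q : MvPowerSeries (Fin 2) K,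
      ∀ e, coeff e q = if e 0 < n then coeff e w else 0 :=
    exists_coeff _
  have hA : X 0 ^ n ∣ w - q := by
    rw [X_pow_dvd_iff]
    intro e he
    rw [map_sub, sub_eq_zero, hq, if_pos he]
  have hB : X 1 ^ m ∣ q := by
    rw [X_pow_dvd_iff]
    intro e he
    rw [hq]
    split_ifs with h0
    · have : e ≤ d := by
        intro k
        fin_cases k <;> simp [d] <;> omega
      simp only [w]
      rw [map_sub, MvPolynomial.coeff_coe, coeff_trunc', if_pos this, sub_self]
    · rfl
  obtain ⟨A, hA⟩ := hA
  obtain ⟨B, hB⟩ := hB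
  exact ⟨trunc' K d g, A, B, by
    simp only [w] at hA
    linear_combination hA + hB⟩


/-- If `f, g ∈ K[[x,y]]` are relatively prime (K algebraically closed), then
`g ≡ u · g'` modulo `(f)` for some unit `u ∈ K[[x,y]]` and polynomial `g' ∈ K[x,y]`. -/
theorem polynomial_mod_curve {K : Type*} [Field K] [IsAlgClosed K]
    (f g : MvPowerSeries (Fin 2) K) (h : IsRelPrime f g) :
    ∃ u : MvPowerSeries (Fin 2) K, IsUnit u ∧
      ∃ g' : MvPolynomial (Fin 2) K,
        g - u * (g' : MvPowerSeries (Fin 2) K) ∈ Ideal.span {f} := by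
  obtain ⟨n, a, b, hab⟩ := X_pow_mem (show (0 : Fin 2) ≠ 1 by decide) f g h
  obtain ⟨m, c, d, hcd⟩ := X_pow_mem (show (1 : Fin 2) ≠ 0 by decide) f g h
  obtain ⟨g', A, B, hg⟩ := exists_poly (n + 1) (m + 1) g
  let t : MvPowerSeries (Fin 2) K :=
    MvPowerSeries.X 0 * (A * b) + MvPowerSeries.X 1 * (B * d)
  have hv : IsUnit (1 - t) := by
    rw [MvPowerSeries.isUnit_iff_constantCoeff]
    simp [t]
  obtain ⟨u, hu⟩ := hv.exists_right_inv
  refine ⟨u, IsUnit.of_mul_eq_one (1 - t) (by rw [mul_comm]; exact hu), g', ?_⟩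
  rw [Ideal.mem_span_singleton]
  refine ⟨u * (MvPowerSeries.X 0 * A * a + MvPowerSeries.X 1 * B * c), ?_⟩
  rw [pow_succ, pow_succ, hab, hcd] at hg
  simp only [t] at hu
  linear_combination u * hg - g * hu
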